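/- Let x_1,…,x_n ∈ [0,1]^d with n ≥ d and suppose no anchored axis-parallel box in [0,1]^d has at least d/4 of the points on its right upper boundary. Then D_n^*(x_1,…,x_n) ≥ d^{3/4}/(372·n^{3/4}). -/

import Mathlib

open scoped Classical

/-- The closed anchored axis-parallel box `[0,a_1] × ⋯ × [0,a_d]`. -/
def anchoredBox (d : ℕ) (a : Fin d → ℝ) : Set (Fin d → ℝ) :=
  {y | ∀ j, 0 ≤ y j ∧ y j ≤ a j}

/-- The star-discrepancy of the points `x 1, …, x n` in `[0,1]^d`. -/
noncomputable def starD (d n : ℕ) (x : Fin n → Fin d → ℝ) : ℝ :=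
  sSup {t : ℝ | ∃ a : Fin d → ℝ, (∀ j, a j ∈ Set.Icc (0:ℝ) 1) ∧
    t = |((Finset.univ.filter (fun k => x k ∈ anchoredBox d a)).card : ℝ) / n - ∏ j, a j|}

/-- The number of distinct subsets of `{x 1, …, x n}` cut out by anchored boxes. -/
noncomputable def interCount (d n : ℕ) (x : Fin n → Fin d → ℝ) : ℕ :=
  Set.ncard {P : Set (Fin d → ℝ) | ∃ a : Fin d → ℝ,
    (∀ j, a j ∈ Set.Icc (0:ℝ) 1) ∧ P = anchoredBox d a ∩ Set.range x}

/-- The number of points lying on the right upper boundary of the box `[0,a]`. -/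
noncomputable def boundaryCount (d n : ℕ) (x : Fin n → Fin d → ℝ) (a : Fin d → ℝ) : ℕ :=
  (Finset.univ.filter (fun k => x k ∈ anchoredBox d a ∧ ∃ j, x k j = a j)).card

theorem mem_anchoredBox_iff {d n : ℕ} {x : Fin n → Fin d → ℝ}
    (hx : ∀ k j, x k j ∈ Set.Icc (0:ℝ) 1) (a : Fin d → ℝ) (k : Fin n) :
    x k ∈ anchoredBox d a ↔ ∀ j, x k j ≤ a j :=
  ⟨fun h j => (h j).2, fun h j => ⟨(hx k j).1, h j⟩⟩

theorem abs_sub_le_starD {d n : ℕ} (x : Fin n → Fin d → ℝ) (a : Fin d → ℝ)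
    (ha : ∀ j, a j ∈ Set.Icc (0:ℝ) 1) :
    |((Finset.univ.filter (fun k => x k ∈ anchoredBox d a)).card : ℝ) / n - ∏ j, a j| ≤
      starD d n x := by
  refine le_csSup ⟨1, ?_⟩ ⟨a, ha, rfl⟩
  rintro t ⟨b, hb, rfl⟩
  have hcard : ((Finset.univ.filter (fun k => x k ∈ anchoredBox d b)).card : ℝ) ≤ n := by
    exact_mod_cast (Finset.card_le_univ _).trans_eq (Fintype.card_fin n)
  have h1 := div_le_one_of_le₀ hcard (Nat.cast_nonneg n)
  have h0 : 0 ≤ ((Finset.univ.filter (fun k => x k ∈ anchoredBox d b)).card : ℝ) / n := by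
    positivity
  have p0 : 0 ≤ ∏ j, b j := Finset.prod_nonneg fun j _ => (hb j).1
  have p1 : ∏ j, b j ≤ 1 := Finset.prod_le_one (fun j _ => (hb j).1) fun j _ => (hb j).2
  rw [abs_le]
  constructor <;> linarith

/-- Boxes containing the same points have volumes differing by at most twice the discrepancy. -/
theorem prod_sub_prod_le_two_mul_starD {d n : ℕ} {x : Fin n → Fin d → ℝ}
    (hx : ∀ k j, x k j ∈ Set.Icc (0:ℝ) 1) {a b : Fin d → ℝ}
    (ha : ∀ j, a j ∈ Set.Icc (0:ℝ) 1) (hb : ∀ j, b j ∈ Set.Icc (0:ℝ) 1)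
    (hab : ∀ k, (∀ j, x k j ≤ a j) ↔ ∀ j, x k j ≤ b j) :
    ∏ j, a j - ∏ j, b j ≤ 2 * starD d n x := by
  have h1 := abs_le.1 (abs_sub_le_starD x a ha)
  have h2 := abs_le.1 (abs_sub_le_starD x b hb)
  simp only [mem_anchoredBox_iff hx] at h1 h2
  simp only [hab] at h1
  linarith [h1.1, h2.2]

/-- The trace of a box on the point set is determined by the points on the right upper boundary
of the smallest box with the same trace. -/
theorem exists_boundary_determining {d n : ℕ} (hd : 0 < d) {x : Fin n → Fin d → ℝ}
    (hx : ∀ k j, x k j ∈ Set.Icc (0:ℝ) 1)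
    (hP : ¬ ∃ a : Fin d → ℝ, (∀ j, a j ∈ Set.Icc (0:ℝ) 1) ∧
      (d : ℝ) / 4 ≤ (boundaryCount d n x a : ℝ)) (a : Fin d → ℝ) :
    ∃ B : Finset (Fin n), 4 * B.card ≤ d ∧
      ∀ k, (∀ j, x k j ≤ a j) ↔ ∀ j, ∃ b ∈ B, x k j ≤ x b j := by
  by_cases hS : ∃ k, ∀ j, x k j ≤ a j
  · have hmax : ∀ j, ∃ m, (∀ j, x m j ≤ a j) ∧ ∀ k, (∀ j, x k j ≤ a j) → x k j ≤ x m j := by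
      intro j
      obtain ⟨m, hm, hmm⟩ := Finset.exists_max_image
        (Finset.univ.filter fun k => ∀ j, x k j ≤ a j) (fun k => x k j)
        (by simpa [Finset.Nonempty] using hS)
      exact ⟨m, by simpa using hm, fun k hk => hmm k (by simpa using hk)⟩
    choose m hm hmm using hmax
    let c : Fin d → ℝ := fun j => x (m j) j
    refine ⟨Finset.univ.filter (fun k => x k ∈ anchoredBox d c ∧ ∃ j, x k j = c j), ?_, ?_⟩
    · have hlt : (boundaryCount d n x c : ℝ) < d / 4 :=
        not_le.1 fun h => hP ⟨c, fun j => hx _ _, h⟩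
      have hle : 4 * (boundaryCount d n x c : ℝ) ≤ d := by linarith
      exact_mod_cast hle
    · intro k
      simp only [Finset.mem_filter, Finset.mem_univ, true_and, mem_anchoredBox_iff hx]
      constructor
      · exact fun hk j => ⟨m j, ⟨fun i => hmm i _ (hm j), j, rfl⟩, hmm j k hk⟩
      · intro h j
        obtain ⟨b, ⟨hb, -⟩, hkb⟩ := h j
        exact hkb.trans ((hb j).trans (hm j j))
  · refine ⟨∅, by simp, fun k => ?_⟩
    simp only [Finset.notMem_empty, false_and, exists_false]
    exact ⟨fun h => (hS ⟨k, h⟩).elim, fun h => (h ⟨0, hd⟩).elim⟩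

/-- There are at most `4 ^ card ι` vectors of naturals indexed by `ι` with sum at most `card ι`. -/
theorem card_le_four_pow_of_sum_le {ι : Type*} [Fintype ι] (G : Finset (ι → ℕ))
    (hG : ∀ s ∈ G, ∑ j, s j ≤ Fintype.card ι) : (G.card : ℝ) ≤ 4 ^ Fintype.card ι := by
  set d := Fintype.card ι with hd
  have hsub : G ⊆ Fintype.piFinset fun _ : ι => Finset.range (d + 1) := by
    intro s hs
    simp only [Fintype.mem_piFinset, Finset.mem_range]
    exact fun j => Nat.lt_succ_of_le
      ((Finset.single_le_sum (fun i _ => Nat.zero_le (s i)) (Finset.mem_univ j)).trans (hG s hs))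
  have hgeom : ∑ l ∈ Finset.range (d + 1), (1 / 2 : ℝ) ^ l ≤ 2 :=
    sum_geometric_two_le _
  have hw : (G.card : ℝ) * (1 / 2) ^ d ≤ 2 ^ d := calc
    (G.card : ℝ) * (1 / 2) ^ d = ∑ s ∈ G, (1 / 2 : ℝ) ^ d := by simp
    _ ≤ ∑ s ∈ G, ∏ j, (1 / 2 : ℝ) ^ s j := by
      refine Finset.sum_le_sum fun s hs => ?_
      rw [Finset.prod_pow_eq_pow_sum]
      exact pow_le_pow_of_le_one (by norm_num) (by norm_num) (hG s hs)
    _ ≤ ∑ s ∈ Fintype.piFinset fun _ : ι => Finset.range (d + 1), ∏ j, (1 / 2 : ℝ) ^ s j :=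
      Finset.sum_le_sum_of_subset_of_nonneg hsub fun _ _ _ => by positivity
    _ = ∏ _j : ι, ∑ l ∈ Finset.range (d + 1), (1 / 2 : ℝ) ^ l := by
      rw [Finset.prod_univ_sum]
    _ ≤ ∏ _j : ι, (2 : ℝ) := Finset.prod_le_prod (fun _ _ => by positivity) fun _ _ => hgeom
    _ = 2 ^ d := by simp [hd]
  have h4 : (4 : ℝ) ^ d = 2 ^ d * 2 ^ d := by rw [← mul_pow]; norm_num
  rw [one_div, inv_pow, ← div_eq_mul_inv, div_le_iff₀ (by positivity)] at hw
  rwa [h4]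

/-- A family of finsets of size at most `m` satisfies `card 𝓑 * t ^ m ≤ exp (n t)`
for `t` in the unit interval. -/
theorem card_mul_pow_le_exp {n m : ℕ} (𝓑 : Finset (Finset (Fin n))) (h𝓑 : ∀ B ∈ 𝓑, B.card ≤ m)
    {t : ℝ} (ht0 : 0 ≤ t) (ht1 : t ≤ 1) : (𝓑.card : ℝ) * t ^ m ≤ Real.exp (n * t) := calc
  (𝓑.card : ℝ) * t ^ m = ∑ B ∈ 𝓑, t ^ m := by simp
  _ ≤ ∑ B ∈ 𝓑, t ^ B.card :=
    Finset.sum_le_sum fun B hB => pow_le_pow_of_le_one ht0 ht1 (h𝓑 B hB)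
  _ ≤ ∑ B ∈ (Finset.univ : Finset (Fin n)).powerset, t ^ B.card :=
    Finset.sum_le_sum_of_subset_of_nonneg (fun B _ => by simp) fun _ _ _ => by positivity
  _ = (t + 1) ^ n := by
    simpa using Finset.sum_pow_mul_eq_add_pow t 1 (Finset.univ : Finset (Fin n))
  _ ≤ Real.exp t ^ n := by
    gcongr
    exact Real.add_one_le_exp t
  _ = Real.exp (n * t) := (Real.exp_nat_mul t n).symm

theorem one_div_add_one_le_one_sub_exp {k : ℝ} (hk : 0 < k) :
    1 / (k + 1) ≤ 1 - Real.exp (-(1 / k)) := by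
  have h : 1 / k + 1 ≤ Real.exp (1 / k) := Real.add_one_le_exp _
  have h' : Real.exp (-(1 / k)) ≤ (1 / k + 1)⁻¹ := by
    rw [Real.exp_neg]
    gcongr
  have e : (1 / k + 1)⁻¹ = 1 - 1 / (k + 1) := by field_simp; ring
  linarith

/-- The corner of a box on the geometric grid with ratio `exp (-1 / (k d))`. -/
noncomputable def gridCorner (d k : ℕ) (i : Fin d → ℕ) (j : Fin d) : ℝ :=
  Real.exp (-((i j : ℝ) / (k * d)))

theorem gridCorner_mem_Icc {d k : ℕ} (i : Fin d → ℕ) (j : Fin d) :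
    gridCorner d k i j ∈ Set.Icc (0:ℝ) 1 :=
  ⟨(Real.exp_pos _).le, Real.exp_le_one_iff.2 (neg_nonpos.2 (by positivity))⟩

theorem prod_gridCorner {d k : ℕ} (i : Fin d → ℕ) :
    ∏ j, gridCorner d k i j = Real.exp (-(((∑ j, i j : ℕ) : ℝ) / (k * d))) := by
  simp only [gridCorner]
  rw [← Real.exp_sum, Finset.sum_neg_distrib, ← Finset.sum_div, Nat.cast_sum]

theorem exp_mul_le_prod_gridCorner_sub {d k : ℕ} (hd : 0 < d) (hk : 0 < k) {i I : Fin d → ℕ}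
    (hik : ∀ j, i j ≤ k) (hs : ∑ j, i j + d ≤ ∑ j, I j) :
    Real.exp (-1) * (1 / ((k : ℝ) + 1)) ≤
      ∏ j, gridCorner d k i j - ∏ j, gridCorner d k I j := by
  have hd' : (0 : ℝ) < d := by exact_mod_cast hd
  have hk' : (0 : ℝ) < k := by exact_mod_cast hk
  have hsum : ((∑ j, i j : ℕ) : ℝ) ≤ k * d := by
    have : ∑ j, i j ≤ ∑ _j : Fin d, k := Finset.sum_le_sum fun j _ => hik j
    have h2 : ∑ j, i j ≤ k * d := by simpa [mul_comm] using this
    exact_mod_cast h2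
  have hs' : ((∑ j, i j : ℕ) : ℝ) + d ≤ ((∑ j, I j : ℕ) : ℝ) := by exact_mod_cast hs
  rw [prod_gridCorner, prod_gridCorner]
  have h1 : Real.exp (-1) ≤ Real.exp (-(((∑ j, i j : ℕ) : ℝ) / (k * d))) := by
    gcongr
    exact div_le_one_of_le₀ hsum (by positivity)
  have h2 : Real.exp (-(((∑ j, I j : ℕ) : ℝ) / (k * d))) ≤
      Real.exp (-(((∑ j, i j : ℕ) : ℝ) / (k * d))) * Real.exp (-(1 / (k : ℝ))) := by
    rw [← Real.exp_add]
    gcongr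
    have e : (1 : ℝ) / k = d / (k * d) := by field_simp
    rw [e, ← neg_add, ← add_div]
    gcongr
  calc Real.exp (-1) * (1 / ((k : ℝ) + 1))
      ≤ Real.exp (-(((∑ j, i j : ℕ) : ℝ) / (k * d))) * (1 - Real.exp (-(1 / (k : ℝ)))) := by
        gcongr
        exact one_div_add_one_le_one_sub_exp hk'
    _ ≤ _ := by linarith

/-- Small discrepancy forces the point set to have many distinct traces: any labelling of grid
boxes that determines the trace has at least `((k + 1) / 4) ^ d` labels. -/
theorem grid_card_le_of_determining {d n k : ℕ} (hd : 0 < d) (hk : 0 < k)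
    {x : Fin n → Fin d → ℝ} (hx : ∀ k j, x k j ∈ Set.Icc (0:ℝ) 1)
    (hD : 2 * starD d n x < Real.exp (-1) * (1 / ((k : ℝ) + 1)))
    {β : Type*} [DecidableEq β] (f : (Fin d → ℕ) → β)
    (hf : ∀ i i', f i = f i' → ∀ p, (∀ j, x p j ≤ gridCorner d k i j) ↔
      ∀ j, x p j ≤ gridCorner d k i' j) :
    ((k : ℝ) + 1) ^ d ≤
      4 ^ d * (((Fintype.piFinset fun _ : Fin d => Finset.range (k + 1)).image f).card : ℝ) := by
  set A := Fintype.piFinset fun _ : Fin d => Finset.range (k + 1) with hA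
  have hAcard : A.card = (k + 1) ^ d := by simp [hA]
  have hfib : ∀ b ∈ A.image f, (A.filter fun i => f i = b).card ≤ 4 ^ d := by
    intro b hb
    obtain ⟨i₀, hi₀, rfl⟩ := Finset.mem_image.1 hb
    set F := A.filter fun i => f i = f i₀ with hF
    have hi₀F : i₀ ∈ F := Finset.mem_filter.2 ⟨hi₀, rfl⟩
    let I : Fin d → ℕ := fun j => F.sup fun i => i j
    have hI : ∀ i ∈ F, ∀ j, i j ≤ I j := fun i hi j => Finset.le_sup (f := fun i => i j) hi
    have hfI : ∀ i ∈ F, ∀ p, (∀ j, x p j ≤ gridCorner d k i j) ↔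
        ∀ j, x p j ≤ gridCorner d k I j := by
      intro i hi p
      constructor
      · intro h j
        obtain ⟨i', hi', he⟩ := Finset.exists_mem_eq_sup F ⟨i₀, hi₀F⟩ fun i => i j
        have h' := (hf i i' ((Finset.mem_filter.1 hi).2.trans
          (Finset.mem_filter.1 hi').2.symm) p).1 h j
        have e : I j = i' j := he
        simpa only [gridCorner, e] using h'
      · intro h j
        refine (h j).trans ?_
        have := hI i hi j
        unfold gridCorner
        gcongr
    have hsum : ∀ i ∈ F, ∑ j, (I j - i j) ≤ d := by
      intro i hi
      by_contra! hlt
      have hik : ∀ j, i j ≤ k := fun j => Nat.lt_succ_iff.1 <| Finset.mem_range.1 <|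
        Fintype.mem_piFinset.1 (Finset.mem_filter.1 hi).1 j
      have hadd : ∑ j, i j + ∑ j, (I j - i j) = ∑ j, I j := by
        rw [← Finset.sum_add_distrib]
        exact Finset.sum_congr rfl fun j _ => Nat.add_sub_cancel' (hI i hi j)
      have h1 := exp_mul_le_prod_gridCorner_sub hd hk hik (I := I) (by omega)
      have h2 := prod_sub_prod_le_two_mul_starD hx (gridCorner_mem_Icc i)
        (gridCorner_mem_Icc I) (hfI i hi)
      linarith
    have hinj : Set.InjOn (fun i j => I j - i j) (F : Set (Fin d → ℕ)) := by
      intro i hi i' hi' h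
      funext j
      have h1 := hI i hi j
      have h2 := hI i' hi' j
      have h3 : I j - i j = I j - i' j := congrFun h j
      omega
    rw [← Finset.card_image_of_injOn hinj]
    have h4 := card_le_four_pow_of_sum_le (F.image fun i j => I j - i j) (by
      intro s hs
      obtain ⟨i, hi, rfl⟩ := Finset.mem_image.1 hs
      simpa using hsum i hi)
    rw [Fintype.card_fin] at h4
    exact_mod_cast h4
  have h := Finset.card_le_mul_card_image A (4 ^ d) hfib
  rw [hAcard] at h
  exact_mod_cast h

theorem discrepancy_lower_no_cheap (d n : ℕ) (hdn : d ≤ n)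
    (x : Fin n → Fin d → ℝ) (hx : ∀ k j, x k j ∈ Set.Icc (0:ℝ) 1)
    (hP : ¬ ∃ a : Fin d → ℝ, (∀ j, a j ∈ Set.Icc (0:ℝ) 1) ∧
      (d : ℝ) / 4 ≤ (boundaryCount d n x a : ℝ)) :
    starD d n x ≥ (d : ℝ) ^ ((3:ℝ)/4) / (372 * (n : ℝ) ^ ((3:ℝ)/4)) := by
  have hd : 0 < d := by
    rcases Nat.eq_zero_or_pos d with rfl | h
    · exact (hP ⟨0, by simp, by simp⟩).elim
    · exact h
  have hd' : (0 : ℝ) < d := by exact_mod_cast hd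
  have hdn' : (d : ℝ) ≤ n := by exact_mod_cast hdn
  have hn' : (0 : ℝ) < n := hd'.trans_le hdn'
  set q : ℝ := n / d with hq
  have hq1 : 1 ≤ q := (one_le_div hd').2 hdn'
  have hq0 : 0 < q := by linarith
  set Q : ℝ := q ^ ((3:ℝ)/4) with hQ
  have hQ1 : 1 ≤ Q := Real.one_le_rpow hq1 (by norm_num)
  have hbound : (d : ℝ) ^ ((3:ℝ)/4) / (372 * (n : ℝ) ^ ((3:ℝ)/4)) = 1 / (372 * Q) := by
    have h1 : (0 : ℝ) < (d : ℝ) ^ ((3:ℝ)/4) := by positivity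
    have h2 : (0 : ℝ) < (n : ℝ) ^ ((3:ℝ)/4) := by positivity
    rw [hQ, hq, Real.div_rpow hn'.le hd'.le]
    field_simp
  rw [hbound, ge_iff_le]
  by_contra! hD
  set k : ℕ := ⌊60 * Q⌋₊ with hk
  have hk_le : (k : ℝ) ≤ 60 * Q := Nat.floor_le (by positivity)
  have hk_lt : 60 * Q < (k : ℝ) + 1 := Nat.lt_floor_add_one _
  have hk0 : 0 < k := Nat.floor_pos.2 (by linarith)
  have hexp : Real.exp 1 < 2.72 := Real.exp_one_lt_d9.trans (by norm_num)
  have hexp0 := Real.exp_pos 1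
  have hsmall : 2 * starD d n x < Real.exp (-1) * (1 / ((k : ℝ) + 1)) := by
    have h1 : 2 * (1 / (372 * Q)) ≤ Real.exp (-1) * (1 / ((k : ℝ) + 1)) := by
      rw [Real.exp_neg, ← one_div, ← mul_div_mul_comm, mul_one, mul_one_div,
        div_le_div_iff₀ (by positivity) (by positivity)]
      nlinarith
    linarith
  choose B hBcard hB using exists_boundary_determining hd hx hP
  have hcount := grid_card_le_of_determining hd hk0 hx hsmall (fun i => B (gridCorner d k i))
    fun i i' h p => by rw [hB, hB, h]
  set 𝓑 := (Fintype.piFinset fun _ : Fin d => Finset.range (k + 1)).image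
    fun i => B (gridCorner d k i)
  have h𝓑 : ∀ C ∈ 𝓑, C.card ≤ d / 4 := by
    intro C hC
    obtain ⟨i, -, rfl⟩ := Finset.mem_image.1 hC
    have := hBcard (gridCorner d k i)
    omega
  have hfew : (𝓑.card : ℝ) ≤ (Real.exp 1 * Q) ^ d := by
    have h := card_mul_pow_le_exp 𝓑 h𝓑 (t := q⁻¹) (by positivity) (inv_le_one_of_one_le₀ hq1)
    have e : (n : ℝ) * q⁻¹ = d * 1 := by rw [hq]; field_simp
    rw [inv_pow, ← div_eq_mul_inv, div_le_iff₀ (by positivity), e, Real.exp_nat_mul] at h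
    rw [mul_pow]
    refine h.trans ?_
    gcongr
    rw [hQ, ← Real.rpow_natCast, ← Real.rpow_natCast, ← Real.rpow_mul hq0.le]
    refine Real.rpow_le_rpow_of_exponent_le hq1 ?_
    have : ((d / 4 : ℕ) : ℝ) ≤ d / 4 := Nat.cast_div_le
    linarith
  have hlt : (4 * (Real.exp 1 * Q)) ^ d < ((k : ℝ) + 1) ^ d :=
    pow_lt_pow_left₀ (by nlinarith) (by positivity) hd.ne'
  have hle : ((k : ℝ) + 1) ^ d ≤ (4 * (Real.exp 1 * Q)) ^ d := by
    rw [mul_pow]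
    exact hcount.trans (mul_le_mul_of_nonneg_left hfew (by positivity))
  exact absurd hle (not_le.2 hlt)
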